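/- Let ξ : U² → ℂ be the unique analytic function satisfying g((1−a)/(1−b)) = (a−b)² ξ(a,b) for all (a,b) ∈ U². Then: (1) there exist real numbers d'_{k,ℓ} > 0 for all nonnegative integers k, ℓ, with d'_{0,0} = 1/24, such that ξ(a,b) = ∑_{k,ℓ ≥ 0} d'_{k,ℓ} a^k b^ℓ for all (a,b) ∈ U²; and (2) for every pair of nonnegative integers (k,ℓ) there exists a real number d''_{k,ℓ} > 0, with d''_{0,0} = 1/24, such that (∂^{k+ℓ}ξ/∂a^k ∂b^ℓ)(a,a) = d''_{k,ℓ}/(1−a)^{k+ℓ+2} for all a ∈ U. -/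

import Mathlib

open Complex Finset MeasureTheory
open scoped Real Classical

noncomputable section

/-- The set of primes `p ≤ y`. -/
def primesLe (y : ℝ) : Finset ℕ := (Finset.Iic ⌊y⌋₊).filter Nat.Prime

/-- `α` satisfies the saddle-point equation `∑_{p ≤ y} log p/(p^α − 1) = log x`. -/
def saddleEq (x y α : ℝ) : Prop :=
  ∑ p ∈ primesLe y, Real.log p / ((p : ℝ) ^ α - 1) = Real.log x

/-- `ū = min{u, π(y)}` where `u = log x/log y`. -/
def ubar (x y : ℝ) : ℝ := min (Real.log x / Real.log y) ((primesLe y).card)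

def sigma2 (y α : ℝ) : ℝ :=
  ∑ p ∈ primesLe y, (Real.log p) ^ 2 * (p : ℝ) ^ α / ((p : ℝ) ^ α - 1) ^ 2

def sigma2t (y α : ℝ) : ℝ :=
  ∑ p ∈ primesLe y, (Real.log p) ^ 2 / ((p : ℝ) ^ α - 1) ^ 2

/-- `ϱ = (1/2)(σ₂ − σ̃₂/3)^{1/2}`. -/
def rhoXY (y α : ℝ) : ℝ := (1 / 2) * Real.sqrt (sigma2 y α - sigma2t y α / 3)

/-- `n` is `y`-friable: every prime factor of `n` is at most `y`. -/
def friable (y : ℝ) (n : ℕ) : Prop := ∀ p : ℕ, p.Prime → p ∣ n → (p : ℝ) ≤ y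

/-- `S(x,y)`: the set of `y`-friable integers `1 ≤ n ≤ x`. -/
def Sxy (x y : ℝ) : Finset ℕ := (Finset.Icc 1 ⌊x⌋₊).filter (friable y)

/-- `Ψ(x,y) = #S(x,y)`. -/
def Psi (x y : ℝ) : ℕ := (Sxy x y).card

/-- `D(x,y;γ) = Ψ(x,y)⁻¹ ∑_{n ∈ S(x,y)} τ(n)⁻¹ #{d ∣ n : d ≥ √n e^γ}`. -/
def Dxy (x y γ : ℝ) : ℝ :=
  (Psi x y : ℝ)⁻¹ * ∑ n ∈ Sxy x y,
    ((n.divisors.card : ℝ))⁻¹ *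
      ((n.divisors.filter (fun d => Real.sqrt n * Real.exp γ ≤ (d : ℝ))).card : ℝ)

/-- `Φ(v) = ∫_v^∞ e^{-z²/2} dz/√(2π)`. -/
def PhiGauss (v : ℝ) : ℝ :=
  ∫ z in Set.Ioi v, Real.exp (-z ^ 2 / 2) / Real.sqrt (2 * Real.pi)

/-- `g(z) = log((z^{1/2} − z^{-1/2})/log z)`, with `g(1) = 0`. -/
def gfun (z : ℂ) : ℂ :=
  if z = 1 then 0
  else Complex.log ((z ^ (2⁻¹ : ℂ) - z ^ (-2⁻¹ : ℂ)) / Complex.log z)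

/-- `Ξ(a,b) = −(1/2)log(1−a) − (1/2)log(1−b) − g((1−a)/(1−b))`. -/
def Xi (a b : ℂ) : ℂ :=
  -(2⁻¹ : ℂ) * Complex.log (1 - a) - (2⁻¹ : ℂ) * Complex.log (1 - b) -
    gfun ((1 - a) / (1 - b))

/-- `f_y(s,w) = ∑_{p ≤ y} Ξ(p^{-s}, p^{-w})`. -/
def fy (y : ℝ) (s w : ℂ) : ℂ := ∑ p ∈ primesLe y, Xi ((p : ℂ) ^ (-s)) ((p : ℂ) ^ (-w))

/-- `F_y(s,w) = exp(f_y(s,w))`. -/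
def Fy (y : ℝ) (s w : ℂ) : ℂ := Complex.exp (fy y s w)

/-- `F_y(σ,κ)` at real arguments, as a (positive) real number. -/
def FyR (y σ κ : ℝ) : ℝ := Real.exp ((fy y (σ : ℂ) (κ : ℂ)).re)

/-- `∂_{kℓ}f(s,w)`: partial derivative `k` times in the first variable and `ℓ` times
in the second. -/
def pdv (k l : ℕ) (f : ℂ → ℂ → ℂ) (s w : ℂ) : ℂ :=
  iteratedDeriv k (fun z => iteratedDeriv l (f z) w) s

/-- `Hess[f_y] = (∂₂₀f_y)(∂₀₂f_y) − (∂₁₁f_y)²`. -/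
def HessC (y : ℝ) (s w : ℂ) : ℂ :=
  pdv 2 0 (fy y) s w * pdv 0 2 (fy y) s w - (pdv 1 1 (fy y) s w) ^ 2

/-- The domain `D_δ(α;y)`. -/
def Ddom (δ α y : ℝ) : Set (ℝ × ℝ) :=
  {p | 0 < p.1 ∧ p.1 ≤ 1 ∧ 0 < p.2 ∧ p.2 ≤ 1 ∧ 0 ≤ (p.1 - α) * (α - p.2) ∧
    1 / (1 + δ) ≤ (1 - (2 : ℝ) ^ (-p.1)) / (1 - (2 : ℝ) ^ (-p.2)) ∧
    (1 - (2 : ℝ) ^ (-p.1)) / (1 - (2 : ℝ) ^ (-p.2)) ≤ 1 + δ ∧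
    |p.1 - p.2| * Real.log y ≤ δ}

/-- `φ_k(s,y)`: the `k`-th derivative in `s` of `φ₀(s,y) = −∑_{p ≤ y} log(1−p^{-s})`. -/
def phiD (y : ℝ) (k : ℕ) (s : ℂ) : ℂ :=
  iteratedDeriv k (fun z => -∑ p ∈ primesLe y, Complex.log (1 - (p : ℂ) ^ (-z))) s

/-- `φ₂(σ,y) = ∑_{p ≤ y} (log p)² p^σ/(p^σ−1)²` for real `σ`. -/
def phi2R (y σ : ℝ) : ℝ :=
  ∑ p ∈ primesLe y, (Real.log p) ^ 2 * (p : ℝ) ^ σ / ((p : ℝ) ^ σ - 1) ^ 2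


theorem multichoose_succ_mul (s : ℝ) (k : ℕ) :
    (k + 1 : ℝ) * Ring.multichoose s (k + 1) = (s + k) * Ring.multichoose s k := by
  have h1 := Ring.factorial_nsmul_multichoose_eq_ascPochhammer s (k + 1)
  have h0 := Ring.factorial_nsmul_multichoose_eq_ascPochhammer s k
  rw [Polynomial.ascPochhammer_smeval_eq_eval, nsmul_eq_mul] at h1 h0
  rw [ascPochhammer_succ_eval, ← h0, Nat.factorial_succ] at h1
  push_cast at h1
  have : (k.factorial : ℝ) ≠ 0 := by positivity
  apply mul_left_cancel₀ this
  linarith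

theorem multichoose_succ_eq (s : ℝ) (k : ℕ) :
    Ring.multichoose s (k + 1) = (s + k) / (k + 1) * Ring.multichoose s k := by
  have := multichoose_succ_mul s k
  field_simp
  linarith

theorem multichoose_pos {s : ℝ} (hs : 0 < s) (k : ℕ) : 0 < Ring.multichoose s k := by
  induction k with
  | zero => simp
  | succ k ih => rw [multichoose_succ_eq]; positivity

theorem multichoose_nonneg {s : ℝ} (hs : 0 ≤ s) (k : ℕ) : 0 ≤ Ring.multichoose s k := by
  induction k with
  | zero => simp
  | succ k ih => rw [multichoose_succ_eq]; positivity

theorem multichoose_le_one {s : ℝ} (hs : 0 ≤ s) (hs' : s ≤ 1) (k : ℕ) :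
    Ring.multichoose s k ≤ 1 := by
  induction k with
  | zero => simp
  | succ k ih =>
    rw [multichoose_succ_eq]
    refine mul_le_one₀ ?_ (multichoose_nonneg hs k) ih
    rw [div_le_one (by positivity)]
    linarith

theorem continuous_multichoose (k : ℕ) : Continuous fun s : ℝ => Ring.multichoose s k := by
  induction k with
  | zero => simpa using continuous_const
  | succ k ih => simp only [multichoose_succ_eq]; fun_prop

theorem multichoose_eq_neg_one_pow_mul_choose (s : ℝ) (k : ℕ) :
    Ring.multichoose s k = (-1) ^ k * Ring.choose (-s) k := by
  rw [Ring.choose_neg, ← Ring.multichoose_eq, Int.negOnePow_def, Units.smul_def]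
  simp [← mul_assoc, ← mul_pow]

theorem sum_multichoose_mul_multichoose (s : ℝ) (n : ℕ) :
    ∑ p ∈ antidiagonal n, Ring.multichoose (1 - s) p.1 * Ring.multichoose s p.2 = 1 := by
  have h := Ring.add_choose_eq (r := -(1 - s)) (s := -s) n (Commute.all _ _)
  have h1 := multichoose_eq_neg_one_pow_mul_choose ((1 - s) + s) n
  rw [neg_add, h, mul_sum, sub_add_cancel, Ring.multichoose_one] at h1
  refine Eq.trans ?_ h1.symm
  refine sum_congr rfl fun p hp => ?_
  rw [multichoose_eq_neg_one_pow_mul_choose, multichoose_eq_neg_one_pow_mul_choose s,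
    ← mem_antidiagonal.1 hp, pow_add]
  ring

theorem hasSum_multichoose_mul_pow {s x : ℝ} (hx : |x| < 1) :
    HasSum (fun n => Ring.multichoose s n * x ^ n) ((1 - x) ^ (-s)) := by
  have h := (Real.one_div_one_sub_rpow_hasFPowerSeriesOnBall_zero s).hasSum (y := x)
    (by simpa [enorm_eq_nnnorm, ← NNReal.coe_lt_coe] using hx)
  rw [Real.rpow_neg (by linarith [abs_lt.1 hx])]
  simpa [FormalMultilinearSeries.ofScalars, Ring.multichoose_eq] using h

/-- The coefficient of `a ^ k * b ^ l` in `∫₀¹ (1 - a) ^ (s - 1) * (1 - b) ^ (-s) ds`. -/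
def betaCoeff (k l : ℕ) : ℝ :=
  ∫ s in (0 : ℝ)..1, Ring.multichoose (1 - s) k * Ring.multichoose s l

theorem continuous_multichoose_mul (k l : ℕ) :
    Continuous fun s : ℝ => Ring.multichoose (1 - s) k * Ring.multichoose s l :=
  ((continuous_multichoose k).comp (by fun_prop : Continuous fun s : ℝ => 1 - s)).mul
    (continuous_multichoose l)

theorem betaCoeff_pos (k l : ℕ) : 0 < betaCoeff k l := by
  refine intervalIntegral.intervalIntegral_pos_of_pos_on
    ((continuous_multichoose_mul k l).intervalIntegrable _ _) (fun s hs => ?_) one_pos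
  exact mul_pos (multichoose_pos (by linarith [hs.2]) k) (multichoose_pos hs.1 l)

theorem betaCoeff_comm (k l : ℕ) : betaCoeff k l = betaCoeff l k := by
  have h := intervalIntegral.integral_comp_sub_left (a := 0) (b := 1)
    (fun s : ℝ => Ring.multichoose (1 - s) l * Ring.multichoose s k) 1
  simp only [sub_sub_cancel, sub_self, sub_zero] at h
  rw [betaCoeff, betaCoeff, ← h]
  simp only [mul_comm]

theorem sum_antidiagonal_betaCoeff (n : ℕ) :
    ∑ p ∈ antidiagonal n, betaCoeff p.1 p.2 = 1 := by
  simp only [betaCoeff]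
  rw [← intervalIntegral.integral_finsetSum
    fun p _ => (continuous_multichoose_mul p.1 p.2).intervalIntegrable _ _]
  simp [sum_multichoose_mul_multichoose]

theorem sum_range_betaCoeff (n : ℕ) : ∑ j ∈ range (n + 1), betaCoeff j (n - j) = 1 := by
  rw [← sum_antidiagonal_betaCoeff n, Nat.sum_antidiagonal_eq_sum_range_succ betaCoeff]

theorem hasSum_betaCoeff {a b : ℝ} (ha : 0 ≤ a) (ha' : a < 1) (hb : 0 ≤ b) (hb' : b < 1) :
    HasSum (fun p : ℕ × ℕ => betaCoeff p.1 p.2 * a ^ p.1 * b ^ p.2)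
      (∫ s in (0 : ℝ)..1, (1 - a) ^ (-(1 - s)) * (1 - b) ^ (-s)) := by
  have hgeo : Summable fun p : ℕ × ℕ => a ^ p.1 * b ^ p.2 :=
    (summable_geometric_of_lt_one ha ha').mul_of_nonneg (summable_geometric_of_lt_one hb hb')
      (fun n => pow_nonneg ha n) (fun n => pow_nonneg hb n)
  have hterm : ∀ p : ℕ × ℕ, betaCoeff p.1 p.2 * a ^ p.1 * b ^ p.2 =
      ∫ s in (0 : ℝ)..1, Ring.multichoose (1 - s) p.1 * Ring.multichoose s p.2 *
        (a ^ p.1 * b ^ p.2) := fun p => by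
    rw [intervalIntegral.integral_mul_const, ← betaCoeff, mul_assoc]
  simp only [hterm]
  have hbound : ∀ p : ℕ × ℕ, ∀ s ∈ Set.uIoc (0 : ℝ) 1,
      ‖Ring.multichoose (1 - s) p.1 * Ring.multichoose s p.2 * (a ^ p.1 * b ^ p.2)‖ ≤
        a ^ p.1 * b ^ p.2 := fun p s hs => by
    rw [Set.uIoc_of_le zero_le_one] at hs
    have h1 := multichoose_nonneg (s := 1 - s) (by linarith [hs.2]) p.1
    have h2 := multichoose_nonneg hs.1.le p.2
    rw [Real.norm_of_nonneg (by positivity)]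
    refine mul_le_of_le_one_left (by positivity) (mul_le_one₀ ?_ h2 ?_)
    · exact multichoose_le_one (by linarith [hs.2]) (by linarith [hs.1]) p.1
    · exact multichoose_le_one hs.1.le hs.2 p.2
  refine intervalIntegral.hasSum_integral_of_dominated_convergence
    (fun p _ => a ^ p.1 * b ^ p.2)
    (fun p => ((continuous_multichoose_mul p.1 p.2).mul continuous_const).aestronglyMeasurable)
    (fun p => .of_forall (hbound p)) (.of_forall fun _ _ => hgeo)
    (by simp) (.of_forall fun s hs => ?_)
  have h1 := hasSum_multichoose_mul_pow (s := 1 - s) (x := a) (by rwa [abs_of_nonneg ha])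
  have h2 := hasSum_multichoose_mul_pow (s := s) (x := b) (by rwa [abs_of_nonneg hb])
  have h := h1.mul h2 (hgeo.of_norm_bounded fun p => by
    convert! hbound p s hs using 2; ring)
  convert! h using 2
  ring

theorem sum_range_mul_betaCoeff (n : ℕ) :
    ∑ j ∈ range (n + 1), (j : ℝ) * betaCoeff j (n - j) = n / 2 := by
  have h1 := sum_range_reflect (fun j => (j : ℝ) * betaCoeff j (n - j)) (n + 1)
  have h2 : ∑ j ∈ range (n + 1),
      ((n + 1 - 1 - j : ℕ) : ℝ) * betaCoeff (n + 1 - 1 - j) (n - (n + 1 - 1 - j)) =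
      ∑ j ∈ range (n + 1), ((n : ℝ) * betaCoeff j (n - j) - j * betaCoeff j (n - j)) := by
    refine sum_congr rfl fun j hj => ?_
    have hj : j ≤ n := Nat.lt_succ_iff.1 (mem_range.1 hj)
    rw [Nat.add_sub_cancel, Nat.sub_sub_self hj, betaCoeff_comm, Nat.cast_sub hj]
    ring
  rw [h2, sum_sub_distrib, ← mul_sum, sum_range_betaCoeff] at h1
  linarith

/-- Summation by parts. -/
theorem sum_range_sum_range (f : ℕ → ℝ) (n : ℕ) :
    ∑ i ∈ range n, ∑ j ∈ range (i + 1), f j = ∑ j ∈ range (n + 1), ((n : ℝ) - j) * f j := by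
  induction n with
  | zero => simp
  | succ n ih =>
    rw [sum_range_succ, ih, sum_range_succ (fun j => ((n + 1 : ℕ) - (j : ℝ)) * f j), sub_self,
      zero_mul, add_zero, ← sum_add_distrib]
    refine sum_congr rfl fun j _ => ?_
    push_cast
    ring

/-- The excess of `1 / 2` over the distribution function of the weights `betaCoeff j (n - j)`. -/
def tailExcess (n i : ℕ) : ℝ := 1 / 2 - ∑ j ∈ range (i + 1), betaCoeff j (n - j)

theorem tailExcess_strictAnti (n : ℕ) : StrictAnti (tailExcess n) := by
  refine strictAnti_nat_of_succ_lt fun i => ?_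
  rw [tailExcess, tailExcess, sum_range_succ _ (i + 1)]
  linarith [betaCoeff_pos (i + 1) (n - (i + 1))]

theorem tailExcess_self (n : ℕ) : tailExcess n n = -(1 / 2) := by
  rw [tailExcess, sum_range_betaCoeff]; norm_num

theorem sum_tailExcess (n : ℕ) : ∑ i ∈ range n, tailExcess n i = 0 := by
  simp only [tailExcess]
  rw [sum_sub_distrib, sum_range_sum_range]
  simp only [sub_mul]
  rw [sum_sub_distrib, ← mul_sum, sum_range_betaCoeff, sum_range_mul_betaCoeff]
  simp
  ring

/-- Partial sums of a strictly decreasing sequence with total sum zero are positive. -/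
theorem sum_range_pos_of_strictAnti {f : ℕ → ℝ} (hf : StrictAnti f) {n k : ℕ} (hk : 0 < k)
    (hkn : k < n) (hsum : ∑ i ∈ range n, f i = 0) : 0 < ∑ i ∈ range k, f i := by
  by_contra! hneg
  have hfk : f k < 0 := by
    by_contra! hpos
    refine absurd hneg (not_le.2 (sum_pos (fun i hi => ?_) ⟨0, mem_range.2 hk⟩))
    exact hpos.trans_lt (hf (mem_range.1 hi))
  have htail : ∑ i ∈ Ico k n, f i < 0 :=
    sum_neg (fun i hi => (hf.antitone (mem_Ico.1 hi).1).trans_lt hfk) ⟨k, by simp [hkn]⟩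
  have := sum_range_add_sum_Ico f hkn.le
  linarith

/-- The Taylor coefficient of `a ^ k * b ^ l` in `ξ`. -/
def xiCoeff (k l : ℕ) : ℝ :=
  (∑ i ∈ range (k + 1), tailExcess (k + l + 2) i) / (k + l + 2 : ℕ)

theorem xiCoeff_pos (k l : ℕ) : 0 < xiCoeff k l :=
  div_pos (sum_range_pos_of_strictAnti (tailExcess_strictAnti _) k.succ_pos (by lia)
    (sum_tailExcess (k + l + 2))) (by positivity)

theorem xiCoeff_le_one (k l : ℕ) : xiCoeff k l ≤ 1 := by
  rw [xiCoeff, div_le_one (by positivity)]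
  calc ∑ i ∈ range (k + 1), tailExcess (k + l + 2) i ≤ ∑ i ∈ range (k + 1), (1 : ℝ) := by
        refine sum_le_sum fun i _ => ?_
        have := sum_nonneg fun j (_ : j ∈ range (i + 1)) => (betaCoeff_pos j (k + l + 2 - j)).le
        rw [tailExcess]
        linarith
    _ ≤ (k + l + 2 : ℕ) := by
        rw [sum_const, card_range, nsmul_one]
        exact_mod_cast (by lia : k + 1 ≤ k + l + 2)

theorem betaCoeff_zero_two : betaCoeff 0 2 = 5 / 12 := by
  have h : ∀ s : ℝ, Ring.multichoose (1 - s) 0 * Ring.multichoose s 2 = s ^ 2 / 2 + s / 2 := by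
    intro s
    rw [multichoose_succ_eq, multichoose_succ_eq]
    simp
    ring
  simp only [betaCoeff, h]
  rw [intervalIntegral.integral_add
    (by apply Continuous.intervalIntegrable; fun_prop)
    (by apply Continuous.intervalIntegrable; fun_prop)]
  simp only [intervalIntegral.integral_div, integral_pow, integral_id]
  norm_num

theorem xiCoeff_zero_zero : xiCoeff 0 0 = 1 / 24 := by
  simp [xiCoeff, tailExcess, betaCoeff_zero_two]
  norm_num

theorem sub_mul_sum_partial_sums (f : ℕ → ℝ) (a b : ℝ) (m : ℕ) :
    (a - b) * ∑ k ∈ range m, (∑ i ∈ range (k + 1), f i) * a ^ k * b ^ (m - 1 - k) =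
      (∑ i ∈ range (m + 1), f i) * a ^ m - ∑ k ∈ range (m + 1), f k * a ^ k * b ^ (m - k) := by
  have hstep : ∀ (F : ℕ → ℝ) (m : ℕ), ∑ k ∈ range (m + 1), F k * a ^ k * b ^ (m - k) =
      b * ∑ k ∈ range m, F k * a ^ k * b ^ (m - 1 - k) + F m * a ^ m := fun F m => by
    rw [sum_range_succ, mul_sum, Nat.sub_self, pow_zero, mul_one]
    congr 1
    refine sum_congr rfl fun k hk => ?_
    rw [show m - k = m - 1 - k + 1 by have := mem_range.1 hk; lia]
    ring
  induction m with
  | zero => simp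
  | succ m ih =>
    rw [Nat.add_sub_cancel, hstep, mul_add, hstep f (m + 1), Nat.add_sub_cancel,
      show (a - b) * (b * ∑ k ∈ range m, (∑ i ∈ range (k + 1), f i) * a ^ k * b ^ (m - 1 - k)) =
        b * ((a - b) * ∑ k ∈ range m, (∑ i ∈ range (k + 1), f i) * a ^ k * b ^ (m - 1 - k)) by ring,
      ih, sum_range_succ f (m + 1)]
    ring

theorem sub_mul_sum_tailExcess (a b : ℝ) (n : ℕ) :
    (a - b) * ∑ k ∈ range n, tailExcess n k * a ^ k * b ^ (n - 1 - k) =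
      ∑ k ∈ range (n + 1), betaCoeff k (n - k) * a ^ k * b ^ (n - k) - a ^ n / 2 - b ^ n / 2 := by
  set f : ℕ → ℝ := fun k => (if k = 0 then 1 / 2 else 0) - betaCoeff k (n - k) with hf
  have hF : ∀ k, ∑ i ∈ range (k + 1), f i = tailExcess n k := fun k => by
    simp [hf, tailExcess]
  have h := sub_mul_sum_partial_sums f a b n
  simp only [hF, tailExcess_self] at h
  rw [h]
  simp only [hf, sub_mul, sum_sub_distrib, ite_mul, zero_mul]
  simp
  ring

theorem sub_sq_mul_sum_xiCoeff (a b : ℝ) (n : ℕ) :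
    (a - b) ^ 2 * ∑ p ∈ antidiagonal n, xiCoeff p.1 p.2 * a ^ p.1 * b ^ p.2 =
      (a ^ (n + 2) / 2 + b ^ (n + 2) / 2 -
        ∑ p ∈ antidiagonal (n + 2), betaCoeff p.1 p.2 * a ^ p.1 * b ^ p.2) / (n + 2 : ℕ) := by
  have h1 := sub_mul_sum_partial_sums (tailExcess (n + 2)) a b (n + 1)
  rw [sum_tailExcess, zero_mul, zero_sub] at h1
  have h2 := sub_mul_sum_tailExcess a b (n + 2)
  have h3 : ∑ p ∈ antidiagonal n, xiCoeff p.1 p.2 * a ^ p.1 * b ^ p.2 =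
      (∑ k ∈ range (n + 1), (∑ i ∈ range (k + 1), tailExcess (n + 2) i) * a ^ k *
        b ^ (n + 1 - 1 - k)) / (n + 2 : ℕ) := by
    rw [Nat.sum_antidiagonal_eq_sum_range_succ fun k l => xiCoeff k l * a ^ k * b ^ l, sum_div]
    refine sum_congr rfl fun k hk => ?_
    rw [xiCoeff, show k + (n - k) + 2 = n + 2 by have := mem_range.1 hk; lia, Nat.add_sub_cancel]
    ring
  rw [h3, Nat.sum_antidiagonal_eq_sum_range_succ fun k l => betaCoeff k l * a ^ k * b ^ l,
    ← mul_div_assoc, pow_two, mul_assoc, h1]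
  congr 1
  simp only [show n + 2 - 1 = n + 1 by lia] at h2
  linarith

theorem HasSum.sum_antidiagonal {f : ℕ × ℕ → ℝ} {s : ℝ} (hf : HasSum f s) :
    HasSum (fun n => ∑ p ∈ antidiagonal n, f p) s := by
  refine (HasAntidiagonal.sigmaAntidiagonalEquivProd.hasSum_iff.2 hf).sigma fun n => ?_
  have h := hasSum_fintype fun p : antidiagonal n => f p
  rwa [univ_eq_attach, sum_attach (antidiagonal n) f] at h

theorem integral_rpow_mul_rpow {A B : ℝ} (hB : 0 < B) (hBA : B < A) :
    ∫ s in (0 : ℝ)..1, A ^ (-(1 - s)) * B ^ (-s) =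
      (A - B) / (A * B * (Real.log A - Real.log B)) := by
  have hA : 0 < A := hB.trans hBA
  have hL : Real.log A - Real.log B ≠ 0 := (sub_pos.2 (Real.log_lt_log hB hBA)).ne'
  have h : ∀ s : ℝ, A ^ (-(1 - s)) * B ^ (-s) =
      A⁻¹ * Real.exp ((Real.log A - Real.log B) * s) := fun s => by
    rw [Real.rpow_def_of_pos hA, Real.rpow_def_of_pos hB, ← Real.exp_add]
    nth_rw 2 [← Real.exp_log hA]
    rw [← Real.exp_neg, ← Real.exp_add]
    congr 1
    ring
  simp only [h]
  rw [intervalIntegral.integral_const_mul,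
    intervalIntegral.integral_comp_mul_left (f := Real.exp) hL, integral_exp, mul_one, mul_zero,
    Real.exp_zero, Real.exp_sub, Real.exp_log hA, Real.exp_log hB, smul_eq_mul]
  field_simp

/-- The homogeneous part of degree `n` of
`(1 - a)⁻¹ / 2 + (1 - b)⁻¹ / 2 - ∫₀¹ (1 - a) ^ (s - 1) * (1 - b) ^ (-s) ds`. -/
def defectPart (a b : ℝ) (n : ℕ) : ℝ :=
  a ^ n / 2 + b ^ n / 2 - ∑ p ∈ antidiagonal n, betaCoeff p.1 p.2 * a ^ p.1 * b ^ p.2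

theorem defectPart_zero (a b : ℝ) : defectPart a b 0 = 0 := by
  have := sum_antidiagonal_betaCoeff 0
  simp at this
  simp [defectPart, this]
  norm_num

theorem defectPart_one (a b : ℝ) : defectPart a b 1 = 0 := by
  have := sum_antidiagonal_betaCoeff 1
  have hc := betaCoeff_comm 0 1
  simp [Nat.antidiagonal_succ] at this
  have h0 : betaCoeff 0 1 = 1 / 2 := by linarith
  simp [defectPart, Nat.antidiagonal_succ, ← hc, h0]
  ring

theorem defectPart_mul (r a b : ℝ) (n : ℕ) :
    defectPart (r * a) (r * b) n = r ^ n * defectPart a b n := by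
  rw [defectPart, defectPart, mul_sub, mul_sum]
  congr 1
  · ring
  · refine sum_congr rfl fun p hp => ?_
    rw [← mem_antidiagonal.1 hp]
    ring

theorem hasSum_defectPart {a b : ℝ} (ha : 0 ≤ a) (hab : a < b) (hb : b < 1) :
    HasSum (defectPart a b) ((1 - a)⁻¹ / 2 + (1 - b)⁻¹ / 2 -
      (b - a) / ((1 - a) * (1 - b) * (Real.log (1 - a) - Real.log (1 - b)))) := by
  have h := (hasSum_betaCoeff ha (hab.trans hb) (ha.trans hab.le) hb).sum_antidiagonal
  rw [integral_rpow_mul_rpow (by linarith) (by linarith),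
    show 1 - a - (1 - b) = b - a by ring] at h
  exact (((hasSum_geometric_of_lt_one ha (hab.trans hb)).div_const 2).add
    ((hasSum_geometric_of_lt_one (ha.trans hab.le) hb).div_const 2)).sub h

/-- The value of `g ((1 - a) / (1 - b))` for real `a < b < 1`. -/
def gReal (a b : ℝ) : ℝ :=
  Real.log (b - a) - Real.log (Real.log (1 - a) - Real.log (1 - b)) - Real.log (1 - a) / 2 -
    Real.log (1 - b) / 2

theorem hasDerivAt_gReal_mul {a b r : ℝ} (hr : 0 < r) (hab : a < b) (ha : 0 < 1 - r * a)
    (hb : 0 < 1 - r * b) :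
    HasDerivAt (fun r => gReal (r * a) (r * b))
      (r⁻¹ * ((1 - r * a)⁻¹ / 2 + (1 - r * b)⁻¹ / 2 - (r * b - r * a) /
        ((1 - r * a) * (1 - r * b) * (Real.log (1 - r * a) - Real.log (1 - r * b))))) r := by
  have hrab : r * a < r * b := by gcongr
  have hL : Real.log (1 - r * a) - Real.log (1 - r * b) ≠ 0 :=
    (sub_pos.2 (Real.log_lt_log hb (by linarith))).ne'
  have hlin : ∀ c : ℝ, HasDerivAt (fun r => r * c) c r := fun c => by
    simpa using (hasDerivAt_id r).mul_const c
  have hA := ((hlin a).const_sub 1).log ha.ne'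
  have hB := ((hlin b).const_sub 1).log hb.ne'
  have h := (((((hlin b).sub (hlin a)).log (sub_pos.2 hrab).ne').sub ((hA.sub hB).log hL)).sub
    (hA.div_const 2)).sub (hB.div_const 2)
  convert! h using 1
  have hba : b - a ≠ 0 := (sub_pos.2 hab).ne'
  have hba' : r * b - r * a ≠ 0 := (sub_pos.2 hrab).ne'
  simp only [Pi.sub_apply]
  generalize Real.log (1 - r * a) - Real.log (1 - r * b) = L at hL ⊢
  rw [← mul_sub]
  field_simp
  ring

theorem hasSum_defectPart_div {a b : ℝ} (ha : 0 ≤ a) (hab : a < b) (hb : b < 1) {G : ℝ → ℝ}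
    (hG : ContinuousOn G (Set.Icc 0 1)) (hG0 : G 0 = 0)
    (hGr : ∀ r, 0 < r → r ≤ 1 → G r = gReal (r * a) (r * b)) :
    HasSum (fun n : ℕ => defectPart a b (n + 2) / (n + 2 : ℕ)) (G 1) := by
  set c : ℕ → ℝ := fun n => defectPart a b (n + 2) with hc
  have hsum : Summable fun n => ‖c n‖ :=
    ((summable_nat_add_iff 2).2 (hasSum_defectPart ha hab hb).summable).norm
  have hle : ∀ n, ∀ r ∈ Set.Icc (0 : ℝ) 1, ‖r ^ (n + 1) * c n‖ ≤ ‖c n‖ := fun n r hr => by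
    rw [norm_mul, norm_pow, Real.norm_of_nonneg hr.1]
    exact mul_le_of_le_one_left (norm_nonneg _) (pow_le_one₀ hr.1 hr.2)
  set H : ℝ → ℝ := fun r => ∑' n, r ^ (n + 1) * c n with hH
  have hHcont : ContinuousOn H (Set.Icc 0 1) :=
    continuousOn_tsum (fun n => by fun_prop) hsum hle
  have hderiv : ∀ r ∈ Set.Ioo (0 : ℝ) 1, HasDerivAt G (H r) r := fun r hr => by
    have hra : r * a ≤ a := mul_le_of_le_one_left ha hr.2.le
    have hrb : r * b ≤ b := mul_le_of_le_one_left (ha.trans hab.le) hr.2.le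
    have hG' := hasDerivAt_gReal_mul hr.1 hab (by linarith) (by linarith)
    have hs := hasSum_defectPart (mul_nonneg hr.1.le ha) (mul_lt_mul_of_pos_left hab hr.1)
      (hrb.trans_lt hb)
    rw [← hasSum_nat_add_iff' 2] at hs
    simp only [sum_range_succ, range_zero, sum_empty, defectPart_zero, defectPart_one,
      add_zero, sub_zero] at hs
    have hs' := hs.mul_left r⁻¹
    have hterm : (fun n => r⁻¹ * defectPart (r * a) (r * b) (n + 2)) =
        fun n => r ^ (n + 1) * c n := by
      funext n
      rw [defectPart_mul, pow_succ r (n + 1)]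
      have := hr.1.ne'
      field_simp
      rfl
    rw [hterm] at hs'
    rw [hH]
    simp only [hs'.tsum_eq]
    refine hG'.congr_of_eventuallyEq ?_
    filter_upwards [Ioo_mem_nhds hr.1 hr.2] with x hx using hGr x hx.1 hx.2.le
  have hFTC := intervalIntegral.integral_eq_sub_of_hasDerivAt_of_le zero_le_one hG hderiv
    (hHcont.intervalIntegrable_of_Icc zero_le_one)
  rw [hG0, sub_zero] at hFTC
  rw [← hFTC]
  have hint : ∀ n : ℕ, c n / (n + 2 : ℕ) = ∫ r in (0 : ℝ)..1, r ^ (n + 1) * c n := fun n => by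
    rw [intervalIntegral.integral_mul_const, integral_pow]
    push_cast
    simp
    ring
  have hmem : ∀ r ∈ Set.uIoc (0 : ℝ) 1, r ∈ Set.Icc (0 : ℝ) 1 := fun r hr => by
    rw [Set.uIoc_of_le zero_le_one] at hr
    exact ⟨hr.1.le, hr.2⟩
  change HasSum (fun n : ℕ => c n / (n + 2 : ℕ)) _
  simp only [hint]
  exact intervalIntegral.hasSum_integral_of_dominated_convergence (fun n _ => ‖c n‖)
    (fun n => (by fun_prop : Continuous fun r : ℝ => r ^ (n + 1) * c n).aestronglyMeasurable)
    (fun n => .of_forall fun r hr => hle n r (hmem r hr)) (.of_forall fun _ _ => hsum) (by simp)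
    (.of_forall fun r hr => (hsum.of_norm_bounded fun n => hle n r (hmem r hr)).hasSum)

theorem sub_sq_mul_tsum_xiCoeff {a b : ℝ} {S : ℝ}
    (hS : HasSum (fun p : ℕ × ℕ => xiCoeff p.1 p.2 * a ^ p.1 * b ^ p.2) S) :
    HasSum (fun n : ℕ => defectPart a b (n + 2) / (n + 2 : ℕ)) ((a - b) ^ 2 * S) := by
  convert! hS.sum_antidiagonal.mul_left ((a - b) ^ 2) using 2 with n
  rw [sub_sq_mul_sum_xiCoeff, defectPart]

theorem gfun_ofReal {a b : ℝ} (hab : a < b) (hb : b < 1) :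
    gfun ((1 - a) / (1 - b)) = gReal a b := by
  have hB : 0 < 1 - b := by linarith
  have hA : 0 < 1 - a := by linarith
  have hz : 0 < (1 - a) / (1 - b) := div_pos hA hB
  have hL : 0 < Real.log (1 - a) - Real.log (1 - b) :=
    sub_pos.2 (Real.log_lt_log hB (by linarith))
  set z : ℝ := (1 - a) / (1 - b) with hzdef
  have hlog : Real.log z = Real.log (1 - a) - Real.log (1 - b) := Real.log_div hA.ne' hB.ne'
  have hz1 : z - 1 = (b - a) / (1 - b) := by
    rw [hzdef]; field_simp; ring
  have hcast : ((1 - a) / (1 - b) : ℂ) = (z : ℂ) := by rw [hzdef]; push_cast; rfl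
  have hne : (z : ℂ) ≠ 1 := by
    norm_cast
    have : 0 < z - 1 := hz1 ▸ div_pos (sub_pos.2 hab) hB
    linarith
  have hpow : ∀ s : ℝ, (z : ℂ) ^ (s : ℂ) = ((z ^ s : ℝ) : ℂ) := fun s =>
    (Complex.ofReal_cpow hz.le s).symm
  have hdiff : z ^ (2⁻¹ : ℝ) - z ^ (-2⁻¹ : ℝ) = (z - 1) * z ^ (-2⁻¹ : ℝ) := by
    rw [sub_mul, one_mul]
    nth_rw 3 [← Real.rpow_one z]
    rw [← Real.rpow_add hz]
    norm_num
  have h1 := hpow 2⁻¹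
  have h2 := hpow (-2⁻¹)
  push_cast at h1 h2
  have hpos : 0 < (z - 1) * z ^ (-2⁻¹ : ℝ) :=
    mul_pos (hz1 ▸ div_pos (sub_pos.2 hab) hB) (Real.rpow_pos_of_pos hz _)
  rw [hcast, gfun, if_neg hne, h1, h2, ← Complex.ofReal_log hz.le, ← Complex.ofReal_sub,
    ← Complex.ofReal_div, hdiff, ← Complex.ofReal_log (by rw [hlog]; positivity), hlog,
    Real.log_div hpos.ne' hL.ne', Real.log_mul (by rw [hz1]; exact (div_pos (sub_pos.2 hab) hB).ne')
    (Real.rpow_pos_of_pos hz _).ne', Real.log_rpow hz, hlog, hz1,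
    Real.log_div (sub_pos.2 hab).ne' hB.ne', gReal]
  congr 1
  ring

/-- The power series with coefficients `xiCoeff`. -/
def xiSum (a b : ℂ) : ℂ := ∑' p : ℕ × ℕ, (xiCoeff p.1 p.2 : ℂ) * a ^ p.1 * b ^ p.2

theorem norm_xiCoeff_le_one (k l : ℕ) : ‖(xiCoeff k l : ℂ)‖ ≤ 1 := by
  rw [Complex.norm_real, Real.norm_of_nonneg (xiCoeff_pos k l).le]
  exact xiCoeff_le_one k l

theorem summable_norm_xiCoeff {r s : ℝ} (hr : 0 ≤ r) (hr' : r < 1) (hs : 0 ≤ s) (hs' : s < 1) :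
    Summable fun p : ℕ × ℕ => ‖(xiCoeff p.1 p.2 : ℂ)‖ * r ^ p.1 * s ^ p.2 := by
  refine Summable.of_nonneg_of_le (fun p => by positivity) (fun p => ?_)
    ((summable_geometric_of_lt_one hr hr').mul_of_nonneg (summable_geometric_of_lt_one hs hs')
      (fun n => pow_nonneg hr n) (fun n => pow_nonneg hs n))
  rw [mul_assoc]
  exact mul_le_of_le_one_left (by positivity) (norm_xiCoeff_le_one _ _)

theorem hasSum_xiSum {a b : ℂ} (ha : ‖a‖ < 1) (hb : ‖b‖ < 1) :
    HasSum (fun p : ℕ × ℕ => (xiCoeff p.1 p.2 : ℂ) * a ^ p.1 * b ^ p.2) (xiSum a b) := by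
  refine Summable.hasSum (.of_norm ?_)
  simpa using summable_norm_xiCoeff (norm_nonneg a) ha (norm_nonneg b) hb

theorem differentiableOn_tsum_mul_pow {ι : Type*} {C : ι → ℂ} {e : ι → ℕ}
    (h : ∀ r : ℝ, 0 ≤ r → r < 1 → Summable fun i => ‖C i‖ * r ^ e i) :
    DifferentiableOn ℂ (fun z => ∑' i, C i * z ^ e i) (Metric.ball 0 1) := by
  intro z hz
  rw [mem_ball_zero_iff] at hz
  obtain ⟨r, hzr, hr⟩ := exists_between hz
  have hd : DifferentiableOn ℂ (fun z => ∑' i, C i * z ^ e i) (Metric.ball 0 r) := by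
    refine differentiableOn_tsum_of_summable_norm (h r ((norm_nonneg z).trans hzr.le) hr)
      (fun i => by fun_prop) Metric.isOpen_ball fun i w hw => ?_
    rw [norm_mul, norm_pow]
    gcongr
    exact (mem_ball_zero_iff.1 hw).le
  exact (hd.differentiableAt (Metric.isOpen_ball.mem_nhds
    (mem_ball_zero_iff.2 hzr))).differentiableWithinAt

theorem differentiableOn_xiSum_left {b : ℂ} (hb : ‖b‖ < 1) :
    DifferentiableOn ℂ (fun a => xiSum a b) (Metric.ball 0 1) := by
  have h := differentiableOn_tsum_mul_pow (C := fun p : ℕ × ℕ => (xiCoeff p.1 p.2 : ℂ) * b ^ p.2)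
    (e := Prod.fst) fun r hr hr' => by
      simpa [mul_right_comm] using summable_norm_xiCoeff hr hr' (norm_nonneg b) hb
  simpa only [xiSum, mul_right_comm] using h

theorem differentiableOn_xiSum_right {a : ℂ} (ha : ‖a‖ < 1) :
    DifferentiableOn ℂ (fun b => xiSum a b) (Metric.ball 0 1) := by
  have h := differentiableOn_tsum_mul_pow (C := fun p : ℕ × ℕ => (xiCoeff p.1 p.2 : ℂ) * a ^ p.1)
    (e := Prod.snd) fun r hr hr' => by
      simpa using summable_norm_xiCoeff (norm_nonneg a) ha hr hr'
  simpa only [xiSum] using h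

theorem eqOn_unitBall_of_eq_ofReal {f g : ℂ → ℂ}
    (hf : DifferentiableOn ℂ f (Metric.ball 0 1)) (hg : DifferentiableOn ℂ g (Metric.ball 0 1))
    {x y : ℝ} (hx : 0 ≤ x) (hxy : x < y) (hy : y < 1)
    (hfg : ∀ t : ℝ, x < t → t < y → f t = g t) : Set.EqOn f g (Metric.ball 0 1) := by
  refine (hf.analyticOnNhd Metric.isOpen_ball).eqOn_of_preconnected_of_frequently_eq
    (hg.analyticOnNhd Metric.isOpen_ball) (convex_ball 0 1).isPreconnected (z₀ := (x : ℂ)) ?_ ?_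
  · simpa [abs_of_nonneg hx] using hxy.trans hy
  · have ht : Filter.Tendsto (fun t : ℝ => (t : ℂ)) (nhdsWithin x (Set.Ioi x))
        (nhdsWithin (x : ℂ) {(x : ℂ)}ᶜ) := by
      refine tendsto_nhdsWithin_iff.2 ⟨?_, ?_⟩
      · exact Complex.continuous_ofReal.continuousAt.tendsto.mono_left nhdsWithin_le_nhds
      · filter_upwards [self_mem_nhdsWithin] with t ht
        simpa using (Set.mem_Ioi.1 ht).ne'
    refine ht.frequently (Filter.Eventually.frequently ?_)
    filter_upwards [Ioo_mem_nhdsGT hxy] with t ht using hfg t ht.1 ht.2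

theorem eq_xiSum_of_real {ξ : ℂ → ℂ → ℂ}
    (hξ : ∀ a b : ℂ, ‖a‖ < 1 → ‖b‖ < 1 → AnalyticAt ℂ (fun p : ℂ × ℂ => ξ p.1 p.2) (a, b))
    (hg : ∀ a b : ℂ, ‖a‖ < 1 → ‖b‖ < 1 → gfun ((1 - a) / (1 - b)) = (a - b) ^ 2 * ξ a b)
    {a b : ℝ} (ha : 0 ≤ a) (hab : a < b) (hb : b < 1) : ξ a b = xiSum a b := by
  have hnorm : ∀ {x : ℝ}, 0 ≤ x → x < 1 → ‖(x : ℂ)‖ < 1 := fun h0 h1 => by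
    rwa [Complex.norm_real, Real.norm_of_nonneg h0]
  have hb0 : 0 ≤ b := ha.trans hab.le
  have ha1 : a < 1 := hab.trans hb
  obtain ⟨S, hS⟩ : Summable fun p : ℕ × ℕ => xiCoeff p.1 p.2 * a ^ p.1 * b ^ p.2 := by
    rw [← Complex.summable_ofReal]
    simpa using (hasSum_xiSum (hnorm ha ha1) (hnorm hb0 hb)).summable
  have hSc : xiSum a b = S := by
    rw [← Complex.hasSum_ofReal] at hS
    push_cast at hS
    exact (hasSum_xiSum (hnorm ha ha1) (hnorm hb0 hb)).unique hS
  set F : ℝ → ℂ := fun r => (((r * a : ℝ) : ℂ) - ((r * b : ℝ) : ℂ)) ^ 2 *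
    ξ ((r * a : ℝ) : ℂ) ((r * b : ℝ) : ℂ) with hF
  have hmul : ∀ {x r : ℝ}, 0 ≤ x → x < 1 → r ∈ Set.Icc (0 : ℝ) 1 →
      ‖((r * x : ℝ) : ℂ)‖ < 1 := fun h0 h1 hr =>
    hnorm (mul_nonneg hr.1 h0) ((mul_le_of_le_one_left h0 hr.2).trans_lt h1)
  have hFr : ∀ r, 0 < r → r ≤ 1 → F r = gReal (r * a) (r * b) := fun r hr0 hr1 => by
    rw [hF, ← gfun_ofReal (mul_lt_mul_of_pos_left hab hr0)
      ((mul_le_of_le_one_left hb0 hr1).trans_lt hb),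
      hg _ _ (hmul ha ha1 ⟨hr0.le, hr1⟩) (hmul hb0 hb ⟨hr0.le, hr1⟩)]
  have hFcont : ContinuousOn F (Set.Icc 0 1) := fun r hr => by
    have hc : ContinuousAt (fun r : ℝ => ξ ((r * a : ℝ) : ℂ) ((r * b : ℝ) : ℂ)) r :=
      ContinuousAt.comp (g := fun p : ℂ × ℂ => ξ p.1 p.2)
        (f := fun r : ℝ => (((r * a : ℝ) : ℂ), ((r * b : ℝ) : ℂ)))
        (hξ _ _ (hmul ha ha1 hr) (hmul hb0 hb hr)).continuousAt (by fun_prop)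
    exact (ContinuousAt.mul (by fun_prop) hc).continuousWithinAt
  have hsum := hasSum_defectPart_div ha hab hb (G := fun r => (F r).re)
    (Complex.continuous_re.comp_continuousOn hFcont) (by simp [hF])
    fun r hr0 hr1 => by rw [hFr r hr0 hr1, Complex.ofReal_re]
  have hval := (sub_sq_mul_tsum_xiCoeff hS).unique hsum
  have h1 : F 1 = (((a - b) ^ 2 * S : ℝ) : ℂ) := by
    rw [hval, hFr 1 one_pos le_rfl, Complex.ofReal_re]
  have hne : ((a : ℂ) - b) ^ 2 ≠ 0 := pow_ne_zero 2 (sub_ne_zero.2 (by exact_mod_cast hab.ne))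
  rw [hSc]
  apply mul_left_cancel₀ hne
  simpa [hF] using h1

theorem eq_xiSum {ξ : ℂ → ℂ → ℂ}
    (hξ : ∀ a b : ℂ, ‖a‖ < 1 → ‖b‖ < 1 → AnalyticAt ℂ (fun p : ℂ × ℂ => ξ p.1 p.2) (a, b))
    (hg : ∀ a b : ℂ, ‖a‖ < 1 → ‖b‖ < 1 → gfun ((1 - a) / (1 - b)) = (a - b) ^ 2 * ξ a b)
    {a b : ℂ} (ha : ‖a‖ < 1) (hb : ‖b‖ < 1) : ξ a b = xiSum a b := by
  have hreal : ∀ y : ℝ, 0 < y → y < 1 → ∀ x : ℂ, ‖x‖ < 1 → ξ x y = xiSum x y := by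
    intro y hy0 hy1 x hx
    have hy : ‖(y : ℂ)‖ < 1 := by rwa [Complex.norm_real, Real.norm_of_nonneg hy0.le]
    refine eqOn_unitBall_of_eq_ofReal (f := fun x => ξ x y) (fun x hx => ?_)
      (differentiableOn_xiSum_left hy) le_rfl hy0 hy1
      (fun t ht0 ht1 => eq_xiSum_of_real hξ hg ht0.le ht1 hy1) (mem_ball_zero_iff.2 hx)
    exact (DifferentiableAt.comp (g := fun p : ℂ × ℂ => ξ p.1 p.2) (f := fun x : ℂ => (x, (y : ℂ)))
      x (hξ x y (mem_ball_zero_iff.1 hx) hy).differentiableAt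
      (by fun_prop)).differentiableWithinAt
  refine eqOn_unitBall_of_eq_ofReal (f := fun y => ξ a y) (fun y hy => ?_)
    (differentiableOn_xiSum_right ha) le_rfl one_half_pos one_half_lt_one
    (fun t ht0 ht1 => hreal t ht0 (ht1.trans one_half_lt_one) a ha) (mem_ball_zero_iff.2 hb)
  exact (DifferentiableAt.comp (g := fun p : ℂ × ℂ => ξ p.1 p.2) (f := fun y : ℂ => (a, y))
    y (hξ a y ha (mem_ball_zero_iff.1 hy)).differentiableAt (by fun_prop)).differentiableWithinAt

theorem iteratedDeriv_eq_of_hasSum {f : ℂ → ℂ} {e : ℕ → ℂ} {x : ℂ} {r : ℝ} (hr : 0 < r)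
    (h : ∀ z, ‖z - x‖ < r → HasSum (fun n => e n * (z - x) ^ n) (f z)) (n : ℕ) :
    iteratedDeriv n f x = n.factorial * e n := by
  have hp : HasFPowerSeriesAt f (.ofScalars ℂ e) x := by
    rw [hasFPowerSeriesAt_iff]
    filter_upwards [Metric.ball_mem_nhds 0 hr] with z hz
    simpa [FormalMultilinearSeries.coeff_ofScalars, mul_comm] using
      h (x + z) (by simpa using hz)
  have h1 := hp.eq_formalMultilinearSeries
    (AnalyticAt.hasFPowerSeriesAt ⟨_, hp⟩)
  have h2 := congrArg (fun p => p.coeff n) h1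
  simp only [FormalMultilinearSeries.coeff_ofScalars] at h2
  have hn : (n.factorial : ℂ) ≠ 0 := by exact_mod_cast n.factorial_ne_zero
  rw [h2]
  field_simp

theorem pdv_eq_of_hasSum {F : ℂ → ℂ → ℂ} {e : ℕ → ℕ → ℂ} {x y : ℂ} {r : ℝ} (hr : 0 < r)
    (h : ∀ z w, ‖z - x‖ < r → ‖w - y‖ < r →
      HasSum (fun p : ℕ × ℕ => e p.1 p.2 * (z - x) ^ p.1 * (w - y) ^ p.2) (F z w)) (k l : ℕ) :
    pdv k l F x y = k.factorial * l.factorial * e k l := by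
  obtain ⟨w, hw, hwy⟩ : ∃ w, ‖w - y‖ < r ∧ w - y ≠ 0 := by
    refine ⟨y + (r / 2 : ℝ), ?_, ?_⟩
    · rw [add_sub_cancel_left, Complex.norm_real, Real.norm_of_nonneg (by positivity)]
      linarith
    · rw [add_sub_cancel_left]
      exact_mod_cast (half_pos hr).ne'
  have hcol : ∀ z, ‖z - x‖ < r → ∀ j, Summable fun i => e i j * (z - x) ^ i := fun z hz j => by
    have hs := (h z w hz hw).summable.comp_injective (Prod.mk_left_injective j)
    exact (summable_mul_right_iff (pow_ne_zero j hwy)).1 hs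
  have hrow : ∀ z, ‖z - x‖ < r →
      iteratedDeriv l (F z) y = l.factorial * ∑' i, e i l * (z - x) ^ i := fun z hz => by
    refine iteratedDeriv_eq_of_hasSum (e := fun j => ∑' i, e i j * (z - x) ^ i) hr
      (fun w hw => ?_) l
    have hs := (Equiv.prodComm ℕ ℕ).hasSum_iff.2 (h z w hz hw)
    exact hs.prod_fiberwise fun j => (hcol z hz j).hasSum.mul_right ((w - y) ^ j)
  rw [pdv, iteratedDeriv_eq_of_hasSum (e := fun i => l.factorial * e i l) hr fun z hz => ?_]
  · ring
  · rw [hrow z hz]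
    simpa only [mul_assoc] using (hcol z hz l).hasSum.mul_left (l.factorial : ℂ)

theorem eq_inv_sq_mul_xi {ξ : ℂ → ℂ → ℂ}
    (hξ : ∀ a b : ℂ, ‖a‖ < 1 → ‖b‖ < 1 → AnalyticAt ℂ (fun p : ℂ × ℂ => ξ p.1 p.2) (a, b))
    (hg : ∀ a b : ℂ, ‖a‖ < 1 → ‖b‖ < 1 → gfun ((1 - a) / (1 - b)) = (a - b) ^ 2 * ξ a b)
    {a u v : ℂ} (ha : a ≠ 1) (hu : ‖u‖ < 1) (hv : ‖v‖ < 1) (hu' : ‖a + (1 - a) * u‖ < 1)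
    (hv' : ‖a + (1 - a) * v‖ < 1) :
    ξ (a + (1 - a) * u) (a + (1 - a) * v) = ((1 - a) ^ 2)⁻¹ * ξ u v := by
  have ha' : 1 - a ≠ 0 := sub_ne_zero.2 ha.symm
  have hcont : ∀ {x y : ℂ}, ‖x‖ < 1 → ‖y‖ < 1 → ContinuousAt (fun x => ξ x y) x :=
    fun {x y} hx hy => ContinuousAt.comp (g := fun p : ℂ × ℂ => ξ p.1 p.2)
      (f := fun x : ℂ => (x, y)) (hξ x y hx hy).continuousAt (by fun_prop)
  have hoff : ∀ x : ℂ, x ≠ v → ‖x‖ < 1 → ‖a + (1 - a) * x‖ < 1 →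
      ξ (a + (1 - a) * x) (a + (1 - a) * v) = ((1 - a) ^ 2)⁻¹ * ξ x v := fun x hxv hx hx' => by
    have h1 := hg _ _ hx' hv'
    have h2 := hg _ _ hx hv
    have hv1 : 1 - v ≠ 0 := sub_ne_zero.2 fun h => by simp [← h] at hv
    rw [show 1 - (a + (1 - a) * x) = (1 - a) * (1 - x) by ring,
      show 1 - (a + (1 - a) * v) = (1 - a) * (1 - v) by ring, mul_div_mul_left _ _ ha', h2,
      show a + (1 - a) * x - (a + (1 - a) * v) = (1 - a) * (x - v) by ring, mul_pow] at h1
    have hxv' : (x - v) ^ 2 ≠ 0 := pow_ne_zero 2 (sub_ne_zero.2 hxv)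
    apply mul_left_cancel₀ hxv'
    rw [mul_left_comm, h1]
    field_simp
  rcases eq_or_ne u v with rfl | huv
  · have hl : ContinuousAt (fun x => ξ (a + (1 - a) * x) (a + (1 - a) * u)) u :=
      ContinuousAt.comp (g := fun x => ξ x (a + (1 - a) * u)) (f := fun x => a + (1 - a) * x)
        (hcont hu' hu') (by fun_prop)
    have hr : ContinuousAt (fun x => ((1 - a) ^ 2)⁻¹ * ξ x u) u :=
      continuousAt_const.mul (hcont hu hu)
    refine tendsto_nhds_unique (hl.tendsto.mono_left (nhdsWithin_le_nhds (s := {u}ᶜ)))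
      ((hr.tendsto.mono_left nhdsWithin_le_nhds).congr' ?_)
    have hn1 : ∀ᶠ x in nhds u, ‖x‖ < 1 := continuous_norm.continuousAt.eventually_lt_const hu
    have hn2 : ∀ᶠ x in nhds u, ‖a + (1 - a) * x‖ < 1 :=
      (by fun_prop : Continuous fun x : ℂ => ‖a + (1 - a) * x‖).continuousAt.eventually_lt_const hu'
    filter_upwards [self_mem_nhdsWithin, hn1.filter_mono nhdsWithin_le_nhds,
      hn2.filter_mono nhdsWithin_le_nhds] with x hx h1 h2 using (hoff x hx h1 h2).symm
  · exact hoff u huv hu hu'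

theorem pdv_diagonal {ξ : ℂ → ℂ → ℂ}
    (hξ : ∀ a b : ℂ, ‖a‖ < 1 → ‖b‖ < 1 → AnalyticAt ℂ (fun p : ℂ × ℂ => ξ p.1 p.2) (a, b))
    (hg : ∀ a b : ℂ, ‖a‖ < 1 → ‖b‖ < 1 → gfun ((1 - a) / (1 - b)) = (a - b) ^ 2 * ξ a b)
    {a : ℂ} (ha : ‖a‖ < 1) (k l : ℕ) :
    pdv k l ξ a a =
      ((k.factorial * l.factorial * xiCoeff k l : ℝ) : ℂ) / (1 - a) ^ (k + l + 2) := by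
  have ha1 : a ≠ 1 := fun h => by simp [h] at ha
  have ha' : 1 - a ≠ 0 := sub_ne_zero.2 ha1.symm
  have hle : 1 - ‖a‖ ≤ ‖1 - a‖ := by simpa using norm_sub_norm_le (1 : ℂ) a
  have hsmall : ∀ {z : ℂ}, ‖z - a‖ < 1 - ‖a‖ → ‖z‖ < 1 ∧ ‖(z - a) / (1 - a)‖ < 1 ∧
      a + (1 - a) * ((z - a) / (1 - a)) = z := fun {z} hz => by
    refine ⟨?_, ?_, ?_⟩
    · linarith [norm_sub_norm_le z a]
    · rw [norm_div, div_lt_one (norm_pos_iff.2 ha')]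
      exact hz.trans_le hle
    · field_simp; ring
  rw [pdv_eq_of_hasSum (e := fun k l => (xiCoeff k l : ℂ) / (1 - a) ^ (k + l + 2))
    (sub_pos.2 ha) fun z w hz hw => ?_]
  · push_cast
    ring
  · obtain ⟨hz1, hzu, hzeq⟩ := hsmall hz
    obtain ⟨hw1, hwv, hweq⟩ := hsmall hw
    have h := eq_inv_sq_mul_xi hξ hg ha1 hzu hwv (hzeq.symm ▸ hz1) (hweq.symm ▸ hw1)
    rw [hzeq, hweq, eq_xiSum hξ hg hzu hwv] at h
    rw [h]
    convert! (hasSum_xiSum hzu hwv).mul_left ((1 - a) ^ 2)⁻¹ using 2 with p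
    rw [div_pow, div_pow]
    field_simp
    ring

/-- Lemma 3.(iii): properties of the analytic function `ξ`. -/
theorem stmt7 :
    ∀ ξ : ℂ → ℂ → ℂ,
      (∀ a b : ℂ, ‖a‖ < 1 → ‖b‖ < 1 →
        AnalyticAt ℂ (fun p : ℂ × ℂ => ξ p.1 p.2) (a, b)) →
      (∀ a b : ℂ, ‖a‖ < 1 → ‖b‖ < 1 →
        gfun ((1 - a) / (1 - b)) = (a - b) ^ 2 * ξ a b) →
      (∃ d' : ℕ → ℕ → ℝ,
        (∀ k l : ℕ, 0 < d' k l) ∧ d' 0 0 = 1 / 24 ∧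
        ∀ a b : ℂ, ‖a‖ < 1 → ‖b‖ < 1 →
          HasSum (fun p : ℕ × ℕ => ((d' p.1 p.2 : ℝ) : ℂ) * a ^ p.1 * b ^ p.2) (ξ a b)) ∧
      (∃ d'' : ℕ → ℕ → ℝ,
        (∀ k l : ℕ, 0 < d'' k l) ∧ d'' 0 0 = 1 / 24 ∧
        ∀ k l : ℕ, ∀ a : ℂ, ‖a‖ < 1 →
          pdv k l ξ a a = ((d'' k l : ℝ) : ℂ) / (1 - a) ^ (k + l + 2)) := by
  intro ξ hξ hg
  refine ⟨⟨xiCoeff, xiCoeff_pos, xiCoeff_zero_zero, fun a b ha hb => ?_⟩,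
    ⟨fun k l => k.factorial * l.factorial * xiCoeff k l, fun k l => ?_, ?_,
      fun k l a ha => pdv_diagonal hξ hg ha k l⟩⟩
  · rw [eq_xiSum hξ hg ha hb]
    exact hasSum_xiSum ha hb
  · have := xiCoeff_pos k l
    positivity
  · simp [xiCoeff_zero_zero]

end
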